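/- Suppose l and h are periodic with period L > 0, that 1 − cos η(L) ≠ 0, and that c₁ = (F(L) − F(L)·cos η(L) + G(L)·sin η(L))/(2(1 − cos η(L))) and c₂ = (G(L) − G(L)·cos η(L) − F(L)·sin η(L))/(2(1 − cos η(L))). Then y(t + L) = y(t) and x'(t + L) = x'(t) for all t ∈ ℝ; consequently x(t + L) = x(t) + T for all t, where T = x(L) − x(0). That is, the profile curve (x, y) is periodic with period L. -/

import Mathlib

open Real

/-- The primitive of a continuous function at a translated point. -/
theorem integral_zero_add_right_eq {f : ℝ → ℝ} (hf : Continuous f) (t L : ℝ) :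
    ∫ u in (0:ℝ)..(t + L), f u =
      (∫ u in (0:ℝ)..L, f u) + ∫ u in (0:ℝ)..t, f (u + L) := by
  rw [intervalIntegral.integral_comp_add_right, zero_add,
    intervalIntegral.integral_add_adjacent_intervals (hf.intervalIntegrable _ _)
      (hf.intervalIntegrable _ _)]

/-- The fundamental theorem of calculus for a function given as a primitive. -/
theorem hasDerivAt_of_eq_integral {f g : ℝ → ℝ} (hf : Continuous f)
    (hg : ∀ t, g t = ∫ u in (0:ℝ)..t, f u) (t : ℝ) : HasDerivAt g (f t) t := by
  rw [funext hg]
  exact intervalIntegral.integral_hasDerivAt_right (hf.intervalIntegrable _ _)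
    (hf.stronglyMeasurableAtFilter _ _) hf.continuousAt

theorem continuous_of_eq_integral {f g : ℝ → ℝ} (hf : Continuous f)
    (hg : ∀ t, g t = ∫ u in (0:ℝ)..t, f u) : Continuous g :=
  continuous_iff_continuousAt.2 fun t => (hasDerivAt_of_eq_integral hf hg t).continuousAt

/-- If `1 − cos η(L) ≠ 0` and `c₁, c₂` take the indicated values, the profile curve
`(x, y)` is periodic with period `L`. -/
theorem periodic_profile_of_generic_case
    (l h : ℝ → ℝ) (hl : ContDiff ℝ (⊤ : ℕ∞) l) (hh : ContDiff ℝ (⊤ : ℕ∞) h)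
    (η F G : ℝ → ℝ)
    (hη : ∀ u, η u = ∫ v in (0:ℝ)..u, 2 * h v)
    (hF : ∀ t, F t = ∫ u in (0:ℝ)..t, l u * sin (η u))
    (hG : ∀ t, G t = ∫ u in (0:ℝ)..t, l u * cos (η u))
    (c₁ c₂ : ℝ)
    (hpos : ∀ t, 0 < (F t - c₁) ^ 2 + (G t - c₂) ^ 2)
    (y x : ℝ → ℝ)
    (hy : ∀ t, y t = Real.sqrt ((F t - c₁) ^ 2 + (G t - c₂) ^ 2))
    (hx : ∀ t, x t = ∫ u in (0:ℝ)..t,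
      (deriv F u * (G u - c₂) - deriv G u * (F u - c₁)) / y u)
    (L : ℝ) (hL : 0 < L)
    (hlper : ∀ t, l (t + L) = l t) (hhper : ∀ t, h (t + L) = h t)
    (hcos : 1 - cos (η L) ≠ 0)
    (hc₁ : c₁ = (F L - F L * cos (η L) + G L * sin (η L)) / (2 * (1 - cos (η L))))
    (hc₂ : c₂ = (G L - G L * cos (η L) - F L * sin (η L)) / (2 * (1 - cos (η L)))) :
    (∀ t, y (t + L) = y t) ∧
    (∀ t, deriv x (t + L) = deriv x t) ∧
    (∀ t, x (t + L) = x t + (x L - x 0)) := by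
  have hlc : Continuous l := hl.continuous
  have hhc : Continuous fun v => 2 * h v := continuous_const.mul hh.continuous
  have hηc : Continuous η := continuous_of_eq_integral hhc hη
  have hsc : Continuous fun u => l u * sin (η u) := hlc.mul (continuous_sin.comp hηc)
  have hcc : Continuous fun u => l u * cos (η u) := hlc.mul (continuous_cos.comp hηc)
  have hFc : Continuous F := continuous_of_eq_integral hsc hF
  have hGc : Continuous G := continuous_of_eq_integral hcc hG
  have hyc : Continuous y := by
    rw [funext hy]
    exact (((hFc.sub continuous_const).pow 2).add ((hGc.sub continuous_const).pow 2)).sqrt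
  have hypos : ∀ t, y t ≠ 0 := fun t => by
    rw [hy]
    exact (Real.sqrt_pos.2 (hpos t)).ne'
  simp only [(hasDerivAt_of_eq_integral hsc hF _).deriv,
    (hasDerivAt_of_eq_integral hcc hG _).deriv] at hx
  have hηL : ∀ t, η (t + L) = η L + η t := fun t => by
    simp only [hη, integral_zero_add_right_eq hhc, hhper]
  have hFL : ∀ t, F (t + L) = F L + (cos (η L) * F t + sin (η L) * G t) := fun t => by
    rw [hF (t + L), integral_zero_add_right_eq hsc, ← hF, hF t, hG t,
      ← intervalIntegral.integral_const_mul, ← intervalIntegral.integral_const_mul,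
      ← intervalIntegral.integral_add ((hsc.intervalIntegrable _ _).const_mul _)
        ((hcc.intervalIntegrable _ _).const_mul _)]
    congr 2 with u
    rw [hlper, hηL, sin_add]
    ring
  have hGL : ∀ t, G (t + L) = G L + (cos (η L) * G t - sin (η L) * F t) := fun t => by
    rw [hG (t + L), integral_zero_add_right_eq hcc, ← hG, hF t, hG t,
      ← intervalIntegral.integral_const_mul, ← intervalIntegral.integral_const_mul,
      ← intervalIntegral.integral_sub ((hcc.intervalIntegrable _ _).const_mul _)
        ((hsc.intervalIntegrable _ _).const_mul _)]
    congr 2 with u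
    rw [hlper, hηL, cos_add]
    ring
  have hfix₁ : c₁ = F L + (cos (η L) * c₁ + sin (η L) * c₂) := by
    rw [hc₁, hc₂]
    field_simp
    linear_combination F L * sin_sq_add_cos_sq (η L)
  have hfix₂ : c₂ = G L + (cos (η L) * c₂ - sin (η L) * c₁) := by
    rw [hc₁, hc₂]
    field_simp
    linear_combination G L * sin_sq_add_cos_sq (η L)
  have hF' : ∀ t, F (t + L) - c₁ = cos (η L) * (F t - c₁) + sin (η L) * (G t - c₂) :=
    fun t => by linear_combination hFL t - hfix₁
  have hG' : ∀ t, G (t + L) - c₂ = cos (η L) * (G t - c₂) - sin (η L) * (F t - c₁) :=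
    fun t => by linear_combination hGL t - hfix₂
  have hyL : ∀ t, y (t + L) = y t := fun t => by
    rw [hy, hy, hF', hG']
    congr 1
    linear_combination ((F t - c₁) ^ 2 + (G t - c₂) ^ 2) * sin_sq_add_cos_sq (η L)
  have hxL : ∀ t, x (t + L) = x t + (x L - x 0) := fun t => by
    have hx0 : x 0 = 0 := by rw [hx, intervalIntegral.integral_same]
    have hxc : Continuous fun u =>
        (l u * sin (η u) * (G u - c₂) - l u * cos (η u) * (F u - c₁)) / y u :=
      ((hsc.mul (hGc.sub continuous_const)).sub
        (hcc.mul (hFc.sub continuous_const))).div hyc hypos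
    rw [hx0, sub_zero, add_comm (x t), hx (t + L), integral_zero_add_right_eq hxc, ← hx, hx t]
    congr 2 with u
    rw [hlper, hηL, hyL, hF', hG', sin_add, cos_add]
    congr 1
    linear_combination (l u * sin (η u) * (G u - c₂) - l u * cos (η u) * (F u - c₁)) *
      sin_sq_add_cos_sq (η L)
  refine ⟨hyL, fun t => ?_, hxL⟩
  rw [← deriv_comp_add_const, funext hxL, deriv_add_const]
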